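/- Let A and B be closable operators on a complex Hilbert space H with common dense domain 𝔇 invariant under both operators (A𝔇 ⊆ 𝔇 and B𝔇 ⊆ 𝔇). Let (p_α)_{α∈I} be a family of orthogonal projections on H such that the closed linear span of the union of their ranges is all of H, and assume that for every α: (i) p_α 𝔇 ⊆ 𝔇; (ii) p_α lies in the commutant of W*(Ā) and in the commutant of W*(B̄) — in particular p_α A ξ = A p_α ξ and p_α B ξ = B p_α ξ for all ξ ∈ 𝔇, so that A and B restrict to closable densely defined operators A_α and B_α on the Hilbert space p_α H with dense domain p_α 𝔇; and (iii) the restrictions A_α and B_α commute strongly as operators on p_α H. Then A and B commute strongly. -/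

import Mathlib

noncomputable section

/-- `x S ⊆ S x` for a bounded operator `x` and an unbounded operator `S`. -/
def PMapCommute {H : Type*} [NormedAddCommGroup H] [InnerProductSpace ℂ H]
    (x : H →L[ℂ] H) (S : H →ₗ.[ℂ] H) : Prop :=
  ∀ ξ : S.domain, ∃ h : x (ξ : H) ∈ S.domain, S ⟨x (ξ : H), h⟩ = x (S ξ)

/-- The set of bounded operators commuting with `S` and `S*` (in the containment sense). -/
def pmapCommutant {H : Type*} [NormedAddCommGroup H] [InnerProductSpace ℂ H] [CompleteSpace H]
    (S : H →ₗ.[ℂ] H) : Set (H →L[ℂ] H) :=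
  {x | PMapCommute x S ∧ PMapCommute x S.adjoint}

/-- The von Neumann algebra `W*(S)` generated by a closed densely defined operator `S`,
defined as the commutant of the set of bounded operators commuting with `S` and `S*`. -/
def vnGen {H : Type*} [NormedAddCommGroup H] [InnerProductSpace ℂ H] [CompleteSpace H]
    (S : H →ₗ.[ℂ] H) : Set (H →L[ℂ] H) :=
  Set.centralizer (pmapCommutant S)

/-- Two closable densely defined operators commute strongly if every element of the
von Neumann algebra generated by the closure of the first commutes with every element of the
von Neumann algebra generated by the closure of the second. -/
def StronglyCommutes {H : Type*} [NormedAddCommGroup H] [InnerProductSpace ℂ H] [CompleteSpace H]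
    (A B : H →ₗ.[ℂ] H) : Prop :=
  ∀ a ∈ vnGen A.closure, ∀ b ∈ vnGen B.closure, Commute a b

/-- `A'`, an operator on the Hilbert subspace `↥K` of `H`, is the restriction of the operator
`A` on `H` to the subspace `D' ⊆ K` of `H`: the domain of `A'` (viewed in `H`) is `D'`, and
`A'` agrees with `A` on it. -/
def IsRestrictionOn {H : Type*} [NormedAddCommGroup H] [InnerProductSpace ℂ H]
    (K D' : Submodule ℂ H) (A : H →ₗ.[ℂ] H) (A' : ↥K →ₗ.[ℂ] ↥K) : Prop :=
  Submodule.map K.subtype A'.domain = D' ∧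
  ∀ (ξ : A'.domain) (h : ((ξ : ↥K) : H) ∈ A.domain),
    ((A' ξ : ↥K) : H) = A ⟨((ξ : ↥K) : H), h⟩

/-- `T` maps the graph of `S₁` into the graph of `S₂`, that is, `T S₁ ⊆ S₂ T`. -/
def Intertwines {E F : Type*} [NormedAddCommGroup E] [InnerProductSpace ℂ E]
    [NormedAddCommGroup F] [InnerProductSpace ℂ F]
    (T : E →L[ℂ] F) (S₁ : E →ₗ.[ℂ] E) (S₂ : F →ₗ.[ℂ] F) : Prop :=
  ∀ x y, (x, y) ∈ S₁.graph → (T x, T y) ∈ S₂.graph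

section Intertwines

variable {E F G : Type*} [NormedAddCommGroup E] [InnerProductSpace ℂ E]
  [NormedAddCommGroup F] [InnerProductSpace ℂ F] [NormedAddCommGroup G] [InnerProductSpace ℂ G]

lemma pmapCommute_iff_intertwines (x : E →L[ℂ] E) (S : E →ₗ.[ℂ] E) :
    PMapCommute x S ↔ Intertwines x S S := by
  constructor
  · intro h u v huv
    obtain ⟨ξ, hξ, hv⟩ := (LinearPMap.mem_graph_iff _).1 huv
    obtain ⟨hm, he⟩ := h ξ
    simp only at hξ hv
    subst hξ hv
    exact (LinearPMap.mem_graph_iff _).2 ⟨⟨_, hm⟩, rfl, he⟩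
  · intro h ξ
    obtain ⟨η, hη, he⟩ := (LinearPMap.mem_graph_iff _).1 (h _ _ (S.mem_graph ξ))
    simp only at hη he
    have hm : x (ξ : E) ∈ S.domain := hη ▸ η.2
    have hη' : (⟨x (ξ : E), hm⟩ : S.domain) = η := Subtype.ext hη.symm
    exact ⟨hm, by rw [hη', he]⟩

lemma Intertwines.comp {T₂ : F →L[ℂ] G} {T₁ : E →L[ℂ] F} {S₁ : E →ₗ.[ℂ] E}
    {S₂ : F →ₗ.[ℂ] F} {S₃ : G →ₗ.[ℂ] G} (h₂ : Intertwines T₂ S₂ S₃)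
    (h₁ : Intertwines T₁ S₁ S₂) : Intertwines (T₂ ∘L T₁) S₁ S₃ :=
  fun x y h => h₂ _ _ (h₁ x y h)

lemma Intertwines.mapsTo_topologicalClosure {T : E →L[ℂ] F} {S₁ : E →ₗ.[ℂ] E}
    {S₂ : F →ₗ.[ℂ] F} (h : Intertwines T S₁ S₂) {x y : E}
    (hxy : (x, y) ∈ S₁.graph.topologicalClosure) :
    (T x, T y) ∈ S₂.graph.topologicalClosure :=
  map_mem_closure (f := Prod.map T T) (t := (S₂.graph : Set (F × F)))
    (T.continuous.prodMap T.continuous) hxy fun q hq => h q.1 q.2 hq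

lemma Intertwines.isClosable {T : E →L[ℂ] F} {S₁ : E →ₗ.[ℂ] E} {S₂ : F →ₗ.[ℂ] F}
    (h : Intertwines T S₁ S₂) (hT : Function.Injective T) (hS₂ : S₂.IsClosable) :
    S₁.IsClosable := by
  refine ⟨S₁.graph.topologicalClosure.toLinearPMap, (Submodule.toLinearPMap_graph_eq _ ?_).symm⟩
  rintro ⟨x, y⟩ hxy (rfl : x = 0)
  have hTy := h.mapsTo_topologicalClosure hxy
  rw [hS₂.graph_closure_eq_closure_graph] at hTy
  exact hT ((S₂.closure.graph_fst_eq_zero_snd hTy (map_zero T)).trans (map_zero T).symm)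

lemma Intertwines.closure {T : E →L[ℂ] F} {S₁ : E →ₗ.[ℂ] E} {S₂ : F →ₗ.[ℂ] F}
    (h : Intertwines T S₁ S₂) (hS₁ : S₁.IsClosable) (hS₂ : S₂.IsClosable) :
    Intertwines T S₁.closure S₂.closure := by
  intro x y hxy
  rw [← hS₁.graph_closure_eq_closure_graph] at hxy
  rw [← hS₂.graph_closure_eq_closure_graph]
  exact h.mapsTo_topologicalClosure hxy

lemma Intertwines.adjoint [CompleteSpace E] [CompleteSpace F] {T : E →L[ℂ] F}
    {S₁ : E →ₗ.[ℂ] E} {S₂ : F →ₗ.[ℂ] F} (h : Intertwines T S₁ S₂)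
    (hS₁ : Dense (S₁.domain : Set E)) (hS₂ : Dense (S₂.domain : Set F)) :
    Intertwines (ContinuousLinearMap.adjoint T) S₂.adjoint S₁.adjoint := by
  intro x y hxy
  rw [LinearPMap.adjoint_graph_eq_graph_adjoint hS₂, Submodule.mem_adjoint_iff] at hxy
  rw [LinearPMap.adjoint_graph_eq_graph_adjoint hS₁, Submodule.mem_adjoint_iff]
  intro a b hab
  simpa only [ContinuousLinearMap.adjoint_inner_right] using hxy _ _ (h a b hab)

end Intertwines

section Compression

variable {H : Type*} [NormedAddCommGroup H] [InnerProductSpace ℂ H]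

/-- The compression of `A` to a closed subspace `K`, with domain `A.domain ∩ K`. -/
def LinearPMap.compression (K : Submodule ℂ H) [K.HasOrthogonalProjection] (A : H →ₗ.[ℂ] H) :
    ↥K →ₗ.[ℂ] ↥K where
  domain := A.domain.comap K.subtype
  toFun := (K.orthogonalProjectionOnto : H →ₗ[ℂ] ↥K) ∘ₗ A.toFun ∘ₗ
    K.subtype.restrict (q := A.domain) fun _ h => h

variable {K : Submodule ℂ H} [CompleteSpace K] {A B : H →ₗ.[ℂ] H}

lemma intertwines_orthogonalProjection_compression (h : Intertwines K.starProjection A A) :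
    Intertwines K.orthogonalProjectionOnto A (A.compression K) := by
  intro x y hxy
  obtain ⟨ξ, hξ, he⟩ := (LinearPMap.mem_graph_iff _).1 (h x y hxy)
  simp only at hξ he
  have hmem : K.starProjection x ∈ A.domain := hξ ▸ ξ.2
  refine (LinearPMap.mem_graph_iff _).2 ⟨⟨K.orthogonalProjectionOnto x, hmem⟩, rfl, ?_⟩
  change K.orthogonalProjectionOnto (A ⟨K.starProjection x, hmem⟩) = K.orthogonalProjectionOnto y
  have : (⟨K.starProjection x, hmem⟩ : A.domain) = ξ := Subtype.ext hξ.symm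
  rw [this, he]
  exact K.orthogonalProjectionOnto_mem_subspace_eq_self (K.orthogonalProjectionOnto y)

lemma coe_compression_apply (h : Intertwines K.starProjection A A)
    (ξ : (A.compression K).domain) :
    ((A.compression K ξ : K) : H) = A ⟨((ξ : K) : H), ξ.2⟩ := by
  obtain ⟨η, hη, he⟩ := (LinearPMap.mem_graph_iff _).1 (h _ _ (A.mem_graph ⟨((ξ : K) : H), ξ.2⟩))
  have hη' : η = ⟨((ξ : K) : H), ξ.2⟩ :=
    Subtype.ext (hη.trans (K.starProjection_eq_self_iff.2 (ξ : K).2))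
  exact he.symm.trans (congrArg A hη')

lemma intertwines_subtypeL_compression (h : Intertwines K.starProjection A A) :
    Intertwines K.subtypeL (A.compression K) A := by
  intro x y hxy
  obtain ⟨ξ, hξ, he⟩ := (LinearPMap.mem_graph_iff _).1 hxy
  simp only at hξ he
  subst hξ he
  exact (LinearPMap.mem_graph_iff _).2 ⟨⟨_, ξ.2⟩, rfl, (coe_compression_apply h ξ).symm⟩

lemma dense_domain_compression (h : Intertwines K.starProjection A A)
    (hA : Dense (A.domain : Set H)) : Dense ((A.compression K).domain : Set K) := by
  have hsurj : Function.Surjective K.orthogonalProjectionOnto :=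
    fun v => ⟨v, K.orthogonalProjectionOnto_mem_subspace_eq_self v⟩
  refine (hsurj.denseRange.dense_image K.orthogonalProjectionOnto.continuous hA).mono ?_
  rintro _ ⟨x, hx, rfl⟩
  exact LinearPMap.mem_domain_of_mem_graph
    (intertwines_orthogonalProjection_compression h _ _ (A.mem_graph ⟨x, hx⟩))

lemma isRestrictionOn_compression (h : Intertwines K.starProjection A A) :
    IsRestrictionOn K (A.domain.map (K.starProjection : H →ₗ[ℂ] H)) A (A.compression K) := by
  refine ⟨?_, fun ξ _ => coe_compression_apply h ξ⟩
  ext x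
  constructor
  · rintro ⟨v, hv, rfl⟩
    exact ⟨v, hv, K.starProjection_eq_self_iff.2 v.2⟩
  · rintro ⟨ξ, hξ, rfl⟩
    exact ⟨K.orthogonalProjectionOnto ξ, LinearPMap.mem_domain_of_mem_graph
      (intertwines_orthogonalProjection_compression h _ _ (A.mem_graph ⟨ξ, hξ⟩)), rfl⟩

lemma extend_mem_pmapCommutant [CompleteSpace H] (h : Intertwines K.starProjection A A)
    (hA : Dense (A.domain : Set H)) (hAc : A.IsClosable) {x : K →L[ℂ] K}
    (hx : x ∈ pmapCommutant (A.compression K).closure) :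
    K.subtypeL ∘L x ∘L K.orthogonalProjectionOnto ∈ pmapCommutant A.closure := by
  have hι := intertwines_subtypeL_compression h
  have hcc : (A.compression K).IsClosable := hι.isClosable K.subtype_injective hAc
  have hd : Dense (A.closure.domain : Set H) := hA.mono A.le_closure.1
  have hdc : Dense ((A.compression K).closure.domain : Set K) :=
    (dense_domain_compression h hA).mono (A.compression K).le_closure.1
  have hι' := hι.closure hcc hAc
  have hπ' := (intertwines_orthogonalProjection_compression h).closure hAc hcc
  have hιa := hι'.adjoint hdc hd
  have hπa := hπ'.adjoint hd hdc
  rw [Submodule.adjoint_subtypeL] at hιa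
  rw [Submodule.adjoint_orthogonalProjectionOnto] at hπa
  exact ⟨(pmapCommute_iff_intertwines _ _).2
      (hι'.comp (((pmapCommute_iff_intertwines _ _).1 hx.1).comp hπ')),
    (pmapCommute_iff_intertwines _ _).2
      (hπa.comp (((pmapCommute_iff_intertwines _ _).1 hx.2).comp hιa))⟩

lemma compress_mem_vnGen [CompleteSpace H] (h : Intertwines K.starProjection A A)
    (hA : Dense (A.domain : Set H)) (hAc : A.IsClosable) {a : H →L[ℂ] H}
    (ha : a ∈ vnGen A.closure) :
    K.orthogonalProjectionOnto ∘L a ∘L K.subtypeL ∈ vnGen (A.compression K).closure := by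
  intro x hx
  have hcomm := ha _ (extend_mem_pmapCommutant h hA hAc hx)
  ext v
  have := congrArg K.orthogonalProjectionOnto (DFunLike.congr_fun hcomm (v : H))
  simpa using congrArg Subtype.val this

lemma commute_on_of_stronglyCommutes_compression [CompleteSpace H]
    (hKA : Intertwines K.starProjection A A) (hKB : Intertwines K.starProjection B B)
    (hA : Dense (A.domain : Set H)) (hB : Dense (B.domain : Set H))
    (hAc : A.IsClosable) (hBc : B.IsClosable)
    (hcomm : StronglyCommutes (A.compression K) (B.compression K))
    {a b : H →L[ℂ] H} (ha : a ∈ vnGen A.closure) (hb : b ∈ vnGen B.closure)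
    (hKa : Commute a K.starProjection) (hKb : Commute b K.starProjection)
    {v : H} (hv : v ∈ K) : a (b v) = b (a v) := by
  have hmem : ∀ {c : H →L[ℂ] H}, Commute c K.starProjection → ∀ w ∈ K,
      K.starProjection (c w) = c w := by
    intro c hc w hw
    have := DFunLike.congr_fun hc.eq w
    simp only [mul_apply_eq_comp, K.starProjection_eq_self_iff.2 hw] at this
    exact this.symm
  have := congrArg Subtype.val (DFunLike.congr_fun
    (hcomm _ (compress_mem_vnGen hKA hA hAc ha) _ (compress_mem_vnGen hKB hB hBc hb)).eq ⟨v, hv⟩)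
  change K.starProjection (a (K.starProjection (b v)))
    = K.starProjection (b (K.starProjection (a v))) at this
  have hbv := hmem hKb v hv
  have hav := hmem hKa v hv
  rwa [hbv, hav, hmem hKa _ (K.starProjection_eq_self_iff.1 hbv),
    hmem hKb _ (K.starProjection_eq_self_iff.1 hav)] at this

end Compression

lemma eq_starProjection_range {H : Type*} [NormedAddCommGroup H] [InnerProductSpace ℂ H]
    [CompleteSpace H] {p : H →L[ℂ] H} (hidem : IsIdempotentElem p) (hsa : IsSelfAdjoint p)
    [CompleteSpace (LinearMap.range (p : H →ₗ[ℂ] H))] :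
    p = (LinearMap.range (p : H →ₗ[ℂ] H)).starProjection := by
  ext v
  refine (Submodule.eq_starProjection_of_mem_of_inner_eq_zero
    (LinearMap.mem_range_self (p : H →ₗ[ℂ] H) v) ?_).symm
  rintro _ ⟨w, rfl⟩
  have hp : p (v - p v) = 0 := by
    rw [map_sub, ← mul_apply_eq_comp, hidem.eq, sub_self]
  have := hsa.isSymmetric (v - p v) w
  simp only [ContinuousLinearMap.coe_coe, hp, inner_zero_left] at this
  exact this.symm

lemma intertwines_of_apply_eq {H : Type*} [NormedAddCommGroup H] [InnerProductSpace ℂ H]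
    {p : H →L[ℂ] H} {A : H →ₗ.[ℂ] H} (hp : ∀ ξ ∈ A.domain, p ξ ∈ A.domain)
    (hcomm : ∀ (ξ : A.domain) (h : p (ξ : H) ∈ A.domain), p (A ξ) = A ⟨p (ξ : H), h⟩) :
    Intertwines p A A :=
  (pmapCommute_iff_intertwines p A).1 fun ξ => ⟨hp ξ ξ.2, (hcomm ξ (hp ξ ξ.2)).symm⟩

/-- lemma 5.3 in the paper.  Let `A, B` be closable operators with common
dense invariant domain `𝔇`, and `(p i)` a family of orthogonal projections whose ranges span a
dense subspace of `H`, each leaving `𝔇` invariant, lying in the commutant of `W*(Ā)` and of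
`W*(B̄)` (in particular commuting with `A` and `B` on `𝔇`), and such that the restrictions of
`A` and `B` to each subspace `pᵢH` commute strongly.  Then `A` and `B` commute strongly. -/
theorem statement1
    {H : Type*} [NormedAddCommGroup H] [InnerProductSpace ℂ H] [CompleteSpace H]
    (𝔇 : Submodule ℂ H) (hdense : Dense (𝔇 : Set H))
    (A B : H →ₗ.[ℂ] H)
    (hAdom : A.domain = 𝔇) (hBdom : B.domain = 𝔇)
    (hAclosable : A.IsClosable) (hBclosable : B.IsClosable)
    (hAinv : ∀ ξ : A.domain, A ξ ∈ 𝔇) (hBinv : ∀ ξ : B.domain, B ξ ∈ 𝔇)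
    {ι : Type*} (p : ι → (H →L[ℂ] H))
    (hidem : ∀ i, IsIdempotentElem (p i))
    (hsa : ∀ i, IsSelfAdjoint (p i))
    -- the closed linear span of the union of the ranges of the `p i` is all of `H`
    (hspan : (⨆ i, LinearMap.range ((p i : H →ₗ[ℂ] H))).topologicalClosure = ⊤)
    -- (i) each `p i` leaves `𝔇` invariant
    (hpinv : ∀ i, ∀ ξ ∈ 𝔇, (p i) ξ ∈ 𝔇)
    -- (ii) each `p i` lies in the commutant of `W*(Ā)` and of `W*(B̄)` ...
    (hpA : ∀ i, p i ∈ Set.centralizer (vnGen A.closure))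
    (hpB : ∀ i, p i ∈ Set.centralizer (vnGen B.closure))
    -- ... in particular `p i` commutes with `A` and `B` on `𝔇`
    (hpAcomm : ∀ i, ∀ (ξ : A.domain) (h : (p i) (ξ : H) ∈ A.domain),
      (p i) (A ξ) = A ⟨(p i) (ξ : H), h⟩)
    (hpBcomm : ∀ i, ∀ (ξ : B.domain) (h : (p i) (ξ : H) ∈ B.domain),
      (p i) (B ξ) = B ⟨(p i) (ξ : H), h⟩)
    -- (iii) the restrictions of `A` and `B` to each `pᵢ H` (with domain `pᵢ 𝔇`)
    -- commute strongly as operators on the Hilbert space `pᵢ H`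
    (hres : ∀ i, ∀ (A' B' : ↥(LinearMap.range ((p i : H →ₗ[ℂ] H))) →ₗ.[ℂ]
        ↥(LinearMap.range ((p i : H →ₗ[ℂ] H)))),
      IsRestrictionOn (LinearMap.range ((p i : H →ₗ[ℂ] H)))
        (Submodule.map ((p i : H →ₗ[ℂ] H)) 𝔇) A A' →
      IsRestrictionOn (LinearMap.range ((p i : H →ₗ[ℂ] H)))
        (Submodule.map ((p i : H →ₗ[ℂ] H)) 𝔇) B B' →
      @StronglyCommutes _ _ _
        (by
          have hset : ((LinearMap.range ((p i : H →ₗ[ℂ] H))) : Set H)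
              = {ξ : H | (p i) ξ = ξ} := by
            ext ξ
            simp only [SetLike.mem_coe, LinearMap.mem_range, Set.mem_setOf_eq,
              ContinuousLinearMap.coe_coe]
            constructor
            · rintro ⟨w, rfl⟩
              conv_lhs => rw [← ContinuousLinearMap.mul_apply, hidem i]
            · intro hξ
              exact ⟨ξ, hξ⟩
          have hclosed : IsClosed ((LinearMap.range ((p i : H →ₗ[ℂ] H))) : Set H) := by
            rw [hset]
            exact isClosed_eq (p i).continuous continuous_id
          exact hclosed.completeSpace_coe)
        A' B') :
    StronglyCommutes A B := by
  subst hAdom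
  intro a ha b hb
  have hle : (⨆ i, LinearMap.range ((p i : H →ₗ[ℂ] H))) ≤
      LinearMap.ker ((a * b - b * a : H →L[ℂ] H) : H →ₗ[ℂ] H) := by
    refine iSup_le fun i v hv => ?_
    have hK : IsClosed (LinearMap.range (p i : H →ₗ[ℂ] H) : Set H) :=
      ContinuousLinearMap.IsIdempotentElem.isClosed_range (hidem i)
    have : CompleteSpace (LinearMap.range (p i : H →ₗ[ℂ] H)) := hK.completeSpace_coe
    have hp := eq_starProjection_range (hidem i) (hsa i)
    have hKA : Intertwines (p i) A A := intertwines_of_apply_eq (hpinv i) (hpAcomm i)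
    have hKB : Intertwines (p i) B B :=
      intertwines_of_apply_eq (by rw [hBdom]; exact hpinv i) (hpBcomm i)
    have hca : Commute a (p i) := hpA i a ha
    have hcb : Commute b (p i) := hpB i b hb
    have hs := hres i
    rw [hp] at hKA hKB hca hcb
    have hAr := isRestrictionOn_compression hKA
    have hBr := isRestrictionOn_compression hKB
    rw [← hp] at hAr hBr
    rw [hBdom] at hBr
    have := commute_on_of_stronglyCommutes_compression hKA hKB hdense
      (by rw [hBdom]; exact hdense) hAclosable hBclosable (hs _ _ hAr hBr) ha hb hca hcb hv
    simp [this]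
  have hker : LinearMap.ker ((a * b - b * a : H →L[ℂ] H) : H →ₗ[ℂ] H) = ⊤ :=
    top_unique (hspan ▸ Submodule.topologicalClosure_minimal _ hle
      (a * b - b * a : H →L[ℂ] H).isClosed_ker)
  refine sub_eq_zero.1 (ContinuousLinearMap.ext fun v => ?_)
  exact (LinearMap.mem_ker.1 (hker ▸ Submodule.mem_top : v ∈ _))
end
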